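/- Let d ≥ 1 and let ρ ∈ Matrix (Fin d) (Fin d) ℂ be positive semidefinite with trace ρ = 1, with positive semidefinite square root √ρ. Let S, T ∈ Matrix (Fin d) (Fin d) ℂ satisfy ‖S‖_op ≤ 1 and ‖T‖_op ≤ 1. Then |trace(√ρ · T · √ρ · S) − trace(S · T · ρ)| ≤ ‖√ρ·T − T·√ρ‖_F. -/

import Mathlib

open scoped ComplexOrder

/-- The Frobenius norm `‖T‖_F = √(trace (T* T))` of a complex matrix. -/
noncomputable def frobNorm {d : ℕ} (T : Matrix (Fin d) (Fin d) ℂ) : ℝ :=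
  Real.sqrt ((Matrix.trace (T.conjTranspose * T)).re)

/-- The `ℓ²`-operator norm of a complex matrix, i.e. the norm of the induced operator on
`EuclideanSpace ℂ (Fin d)`. -/
noncomputable def opNorm {d : ℕ} (T : Matrix (Fin d) (Fin d) ℂ) : ℝ :=
  ‖Matrix.toEuclideanCLM (𝕜 := ℂ) (n := Fin d) T‖

theorem frobNorm_eq_sqrt_sum {d : ℕ} (A : Matrix (Fin d) (Fin d) ℂ) :
    frobNorm A = √(∑ p : Fin d × Fin d, ‖A p.2 p.1‖ ^ 2) := by
  rw [frobNorm, Fintype.sum_prod_type]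
  congr 1
  simp only [Matrix.trace, Matrix.diag_apply, Matrix.mul_apply, Matrix.conjTranspose_apply,
    Complex.re_sum]
  refine Finset.sum_congr rfl fun i _ => Finset.sum_congr rfl fun j _ => ?_
  rw [← Complex.normSq_eq_norm_sq, Complex.star_def, ← Complex.normSq_eq_conj_mul_self,
    Complex.ofReal_re]

theorem frobNorm_conjTranspose {d : ℕ} (A : Matrix (Fin d) (Fin d) ℂ) :
    frobNorm A.conjTranspose = frobNorm A := by
  rw [frobNorm, frobNorm, Matrix.conjTranspose_conjTranspose, Matrix.trace_mul_comm]

/-- Cauchy–Schwarz for the Hilbert–Schmidt pairing. -/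
theorem norm_trace_mul_le_frobNorm_mul {d : ℕ} (A B : Matrix (Fin d) (Fin d) ℂ) :
    ‖Matrix.trace (A * B)‖ ≤ frobNorm A * frobNorm B := by
  have h : Matrix.trace (A * B) = ∑ p : Fin d × Fin d, A p.1 p.2 * B p.2 p.1 := by
    rw [Fintype.sum_prod_type]
    simp only [Matrix.trace, Matrix.diag_apply, Matrix.mul_apply]
  rw [h, ← frobNorm_conjTranspose A, frobNorm_eq_sqrt_sum, frobNorm_eq_sqrt_sum]
  simp only [Matrix.conjTranspose_apply, norm_star]
  refine (norm_sum_le _ _).trans ?_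
  simp only [norm_mul]
  exact Real.sum_mul_le_sqrt_mul_sqrt _ _ _

theorem opNorm_conjTranspose {d : ℕ} (A : Matrix (Fin d) (Fin d) ℂ) :
    opNorm A.conjTranspose = opNorm A :=
  Matrix.l2_opNorm_conjTranspose A

theorem frobNorm_mul_le_of_opNorm_le_one {d : ℕ} (A B : Matrix (Fin d) (Fin d) ℂ)
    (hA : opNorm A ≤ 1) : frobNorm (A * B) ≤ frobNorm B := by
  rw [frobNorm_eq_sqrt_sum, frobNorm_eq_sqrt_sum, Fintype.sum_prod_type, Fintype.sum_prod_type]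
  refine Real.sqrt_le_sqrt (Finset.sum_le_sum fun i _ => ?_)
  have h : ‖Matrix.toEuclideanCLM (𝕜 := ℂ) (n := Fin d) A (WithLp.toLp 2 (B.col i))‖ ≤
      ‖WithLp.toLp 2 (B.col i)‖ := by
    simpa using ContinuousLinearMap.le_of_opNorm_le _ hA (WithLp.toLp 2 (B.col i))
  rw [Matrix.toEuclideanCLM_toLp] at h
  have h2 := pow_le_pow_left₀ (norm_nonneg _) h 2
  rw [EuclideanSpace.norm_sq_eq, EuclideanSpace.norm_sq_eq] at h2
  exact h2

/-- If `ρ` is a density matrix with positive semidefinite square root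
`√ρ`, and `S, T` are contractions, then
`|tr(√ρ · T · √ρ · S) − tr(S · T · ρ)| ≤ ‖√ρ·T − T·√ρ‖_F`. -/
theorem stmt_16 (d : ℕ) (hd : 1 ≤ d) (ρ sqrtρ : Matrix (Fin d) (Fin d) ℂ)
    (hρ : ρ.PosSemidef) (hρtr : Matrix.trace ρ = 1)
    (hs : sqrtρ.PosSemidef) (hss : sqrtρ * sqrtρ = ρ)
    (S T : Matrix (Fin d) (Fin d) ℂ)
    (hS : opNorm S ≤ 1) (hT : opNorm T ≤ 1) :
    ‖Matrix.trace (sqrtρ * T * sqrtρ * S) - Matrix.trace (S * T * ρ)‖ ≤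
      frobNorm (sqrtρ * T - T * sqrtρ) := by
  have key : Matrix.trace (sqrtρ * T * sqrtρ * S) - Matrix.trace (S * T * ρ) =
      Matrix.trace (sqrtρ * S * (sqrtρ * T - T * sqrtρ)) := by
    rw [← hss, Matrix.mul_sub, Matrix.trace_sub, ← Matrix.trace_mul_comm (sqrtρ * T)]
    congr 1
    · simp only [Matrix.mul_assoc]
    · rw [← Matrix.mul_assoc, Matrix.trace_mul_comm (S * T * sqrtρ)]
      simp only [Matrix.mul_assoc]
  have hone : frobNorm sqrtρ = 1 := by
    rw [frobNorm, hs.isHermitian.eq, hss, hρtr, Complex.one_re, Real.sqrt_one]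
  have hle : frobNorm (sqrtρ * S) ≤ 1 := by
    rw [← frobNorm_conjTranspose, Matrix.conjTranspose_mul, hs.isHermitian.eq, ← hone]
    exact frobNorm_mul_le_of_opNorm_le_one _ _ ((opNorm_conjTranspose S).trans_le hS)
  rw [key]
  exact (norm_trace_mul_le_frobNorm_mul _ _).trans
    (mul_le_of_le_one_left (Real.sqrt_nonneg _) hle)
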